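/- Let ε = e^{iπ/4}, ω = e^{2πi/3}, R = ℤ[ε, ω] ⊆ ℂ, and let S = (1/√2)·[[−1, i], [−i, 1]], T = (1/√2)·[[ε, ε], [ε³, ε⁷]], U = (1/√2)·[[1, 1], [i, 1]] (2×2 complex matrices). Let G_{12} be the subgroup of GL_2(ℂ) generated by U S U^{−1} and U T U^{−1} (these matrices have entries in R). Then the ring of invariants R[x, y]^{G_{12}} equals R[f, g], where f = (i+1)x⁵y − 5x⁴y² + 5(1−i)x³y³ + 5i x²y⁴ − (i+1)xy⁵ and g = x⁸ + 4(i−1)x⁷y − 14i x⁶y² + 14(i+1)x⁵y³ − 21x⁴y⁴ + 14(1−i)x³y⁵ + 14i x²y⁶ − 4(i+1)xy⁷ + y⁸, and f, g are algebraically independent; in particular R[x,y]^{G_{12}} is a polynomial ring over R. -/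

import Mathlib

set_option synthInstance.maxHeartbeats 1000000
set_option maxHeartbeats 1000000

open MvPolynomial Complex

/-- `ε = e^{iπ/4}`, a primitive eighth root of unity. -/
noncomputable def ε : ℂ := Complex.exp (Real.pi * Complex.I / 4)

/-- `ω = e^{2πi/3}`, a primitive third root of unity. -/
noncomputable def ω : ℂ := Complex.exp (2 * Real.pi * Complex.I / 3)

/-- `S = (1/√2)·[[−1, i], [−i, 1]]`. -/
noncomputable def Smat : Matrix (Fin 2) (Fin 2) ℂ :=
  ((Real.sqrt 2 : ℂ))⁻¹ • !![-1, I; -I, 1]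

/-- `T = (1/√2)·[[ε, ε], [ε³, ε⁷]]`. -/
noncomputable def Tmat : Matrix (Fin 2) (Fin 2) ℂ :=
  ((Real.sqrt 2 : ℂ))⁻¹ • !![ε, ε; ε^3, ε^7]

/-- `U = (1/√2)·[[1, 1], [i, 1]]`. -/
noncomputable def Umat : Matrix (Fin 2) (Fin 2) ℂ :=
  ((Real.sqrt 2 : ℂ))⁻¹ • !![1, 1; I, 1]

/-- The ring `R = ℤ[ε, ω] ⊆ ℂ`. -/
noncomputable def Rring : Subring ℂ := Subring.closure {ε, ω}

/-- The algebra endomorphism of `ℂ[x, y]` given by the linear substitution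
`x_i ↦ ∑_j M_{i,j} x_j` for a matrix `M`. -/
noncomputable def actC (M : Matrix (Fin 2) (Fin 2) ℂ) :
    MvPolynomial (Fin 2) ℂ →ₐ[ℂ] MvPolynomial (Fin 2) ℂ :=
  aeval fun i => ∑ j, C (M i j) * X j

/-- For a subring `R ⊆ ℂ` and a subgroup `G ⊆ GL_2(ℂ)`, the invariant ring `R[x, y]^G`:
the `R`-subalgebra of `ℂ[x, y]` consisting of the polynomials with all coefficients in `R`
that are fixed by the substitution action of every element of `G`. -/
noncomputable def invariantRingC (R : Subring ℂ) (G : Subgroup (GL (Fin 2) ℂ)) :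
    Subalgebra ↥R (MvPolynomial (Fin 2) ℂ) :=
  (MvPolynomial.mapAlgHom (R := ↥R) (σ := Fin 2) (Algebra.ofId ↥R ℂ)).range ⊓
    Subalgebra.restrictScalars ↥R
      (⨅ g ∈ G, AlgHom.equalizer (actC (g : Matrix (Fin 2) (Fin 2) ℂ)) (AlgHom.id ℂ _))

/-- The variable `x`. -/
noncomputable def xv : MvPolynomial (Fin 2) ℂ := X 0
/-- The variable `y`. -/
noncomputable def yv : MvPolynomial (Fin 2) ℂ := X 1

/-- `f = (i+1)x⁵y − 5x⁴y² + 5(1−i)x³y³ + 5i x²y⁴ − (i+1)xy⁵`. -/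
noncomputable def fpoly : MvPolynomial (Fin 2) ℂ :=
  C (I + 1) * xv^5 * yv - 5 * xv^4 * yv^2 + C (5*(1 - I)) * xv^3 * yv^3
    + C (5*I) * xv^2 * yv^4 - C (I + 1) * xv * yv^5

/-- `g = x⁸ + 4(i−1)x⁷y − 14i x⁶y² + 14(i+1)x⁵y³ − 21x⁴y⁴ + 14(1−i)x³y⁵ + 14i x²y⁶
      − 4(i+1)xy⁷ + y⁸`. -/
noncomputable def gpoly : MvPolynomial (Fin 2) ℂ :=
  xv^8 + C (4*(I - 1)) * xv^7 * yv - C (14*I) * xv^6 * yv^2 + C (14*(I + 1)) * xv^5 * yv^3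
    - 21 * xv^4 * yv^4 + C (14*(1 - I)) * xv^3 * yv^5 + C (14*I) * xv^2 * yv^6
    - C (4*(I + 1)) * xv * yv^7 + yv^8

/-- `h = 2x¹² + 12(i−1)x¹¹y − 66i x¹⁰y² + 110(i+1)x⁹y³ − 231x⁸y⁴ + 132(1−i)x⁷y⁵
      + 132(i+1)x⁵y⁷ − 231x⁴y⁸ + 110(1−i)x³y⁹ + 66i x²y¹⁰ − 12(i+1)xy¹¹ + 2y¹²`. -/
noncomputable def hpoly : MvPolynomial (Fin 2) ℂ :=
  2 * xv^12 + C (12*(I - 1)) * xv^11 * yv - C (66*I) * xv^10 * yv^2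
    + C (110*(I + 1)) * xv^9 * yv^3 - 231 * xv^8 * yv^4 + C (132*(1 - I)) * xv^7 * yv^5
    + C (132*(I + 1)) * xv^5 * yv^7 - 231 * xv^4 * yv^8 + C (110*(1 - I)) * xv^3 * yv^9
    + C (66*I) * xv^2 * yv^10 - C (12*(I + 1)) * xv * yv^11 + 2 * yv^12

/-- `G₁₂`: the subgroup of `GL_2(ℂ)` generated by `U S U⁻¹` and `U T U⁻¹`
(Shephard–Todd group number 12 in its integral reflection representation). -/
noncomputable def G12 : Subgroup (GL (Fin 2) ℂ) :=
  Subgroup.closure {g | (g : Matrix (Fin 2) (Fin 2) ℂ) = Umat * Smat * Umat⁻¹ ∨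
    (g : Matrix (Fin 2) (Fin 2) ℂ) = Umat * Tmat * Umat⁻¹}

/-! ### Polynomials with coefficients in `R` -/

theorem sqrt_two_sq : (Real.sqrt 2 : ℂ) ^ 2 = 2 := by
  rw [← ofReal_pow, Real.sq_sqrt (by norm_num)]; norm_num

theorem sqrt_two_ne_zero : (Real.sqrt 2 : ℂ) ≠ 0 := by
  intro h
  have := sqrt_two_sq
  rw [h] at this
  norm_num at this

theorem ε_eq : ε = (Real.sqrt 2 : ℂ)⁻¹ * (1 + I) := by
  have h : (Real.pi * Complex.I / 4 : ℂ) = ((Real.pi / 4 : ℝ) : ℂ) * I := by push_cast; ring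
  rw [ε, h, exp_mul_I, ← ofReal_cos, ← ofReal_sin, Real.cos_pi_div_four, Real.sin_pi_div_four]
  push_cast
  field_simp [sqrt_two_ne_zero]
  linear_combination (1 + I) * sqrt_two_sq

theorem inv_sqrt_two_sq : ((Real.sqrt 2 : ℂ)⁻¹) ^ 2 = 1 / 2 := by
  rw [inv_pow, sqrt_two_sq]; norm_num

theorem I_mem_Rring : I ∈ Rring := by
  have h : ε ^ 2 = I := by
    rw [ε_eq]
    linear_combination (1 + I) ^ 2 * inv_sqrt_two_sq + (1 / 2) * I_sq
  rw [← h]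
  exact pow_mem (Subring.subset_closure (by simp)) 2

/-- The subalgebra `R[x, y]` of `ℂ[x, y]`. -/
noncomputable def integralPolys : Subalgebra ↥Rring (MvPolynomial (Fin 2) ℂ) :=
  (MvPolynomial.mapAlgHom (R := ↥Rring) (σ := Fin 2) (Algebra.ofId ↥Rring ℂ)).range

theorem mem_integralPolys {p : MvPolynomial (Fin 2) ℂ} :
    p ∈ integralPolys ↔ ∀ d, p.coeff d ∈ Rring := by
  rw [← Subalgebra.mem_toSubmodule, integralPolys, range_mapAlgHom, mem_coeffsIn]
  refine forall_congr' fun d => ?_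
  rw [Subalgebra.mem_toSubmodule, AlgHom.mem_range]
  constructor
  · rintro ⟨r, hr⟩
    rw [← hr]
    exact r.2
  · intro h
    exact ⟨⟨_, h⟩, rfl⟩

theorem C_mem_integralPolys {c : ℂ} (hc : c ∈ Rring) : C c ∈ integralPolys :=
  integralPolys.algebraMap_mem ⟨c, hc⟩

theorem X_mem_integralPolys (i : Fin 2) : X i ∈ integralPolys := by
  classical
  rw [mem_integralPolys]
  intro d
  rw [coeff_X]
  split_ifs
  exacts [one_mem _, zero_mem _]

/-! ### Linear forms with a unit coefficient -/

/-- The linear form `x_i + c x_j`. -/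
noncomputable def lin (i j : Fin 2) (c : ℂ) : MvPolynomial (Fin 2) ℂ := X i + C c * X j

theorem dvd_of_aeval_eq_zero {l : MvPolynomial (Fin 2) ℂ} {v : Fin 2 → MvPolynomial (Fin 2) ℂ}
    (hv : ∀ k, l ∣ X k - v k) {p : MvPolynomial (Fin 2) ℂ} (hp : aeval v p = 0) : l ∣ p := by
  have h : (Ideal.Quotient.mkₐ ℂ (Ideal.span {l})).comp (aeval v)
      = Ideal.Quotient.mkₐ ℂ (Ideal.span {l}) := by
    refine MvPolynomial.algHom_ext fun k => ?_
    rw [AlgHom.comp_apply, aeval_X]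
    refine (Ideal.Quotient.eq.2 ?_).symm
    exact Ideal.mem_span_singleton.2 (hv k)
  have h1 := DFunLike.congr_fun h p
  rw [AlgHom.comp_apply, hp, map_zero] at h1
  exact Ideal.mem_span_singleton.1 (Ideal.Quotient.eq_zero_iff_mem.1 h1.symm)

theorem lin_dvd_iff {i j : Fin 2} (hij : i ≠ j) (c : ℂ) (p : MvPolynomial (Fin 2) ℂ) :
    lin i j c ∣ p ↔ aeval (Function.update X i (-(C c * X j))) p = 0 := by
  constructor
  · rintro ⟨q, rfl⟩
    rw [map_mul, lin]
    simp [Function.update_of_ne hij.symm, algebraMap_eq]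
  · refine dvd_of_aeval_eq_zero fun k => ?_
    by_cases hk : k = i
    · subst hk
      simp [lin]
    · simp [Function.update_of_ne hk]

theorem lin_ne_zero {i j : Fin 2} (hij : i ≠ j) (c : ℂ) : lin i j c ≠ 0 := by
  intro h
  have := congrArg (eval (Function.update 0 i 1)) h
  simp [lin, Function.update_of_ne hij.symm] at this

theorem prime_lin {i j : Fin 2} (hij : i ≠ j) (c : ℂ) : Prime (lin i j c) := by
  refine ⟨lin_ne_zero hij c, fun h => ?_, fun p q h => ?_⟩
  · have := (lin_dvd_iff hij c 1).1 h.dvd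
    simp at this
  · simpa only [lin_dvd_iff hij, map_mul, mul_eq_zero] using h

theorem not_lin_dvd_of_eval {i j : Fin 2} {c : ℂ} {p : MvPolynomial (Fin 2) ℂ} (v : Fin 2 → ℂ)
    (h0 : eval v (lin i j c) = 0) (hp : eval v p ≠ 0) : ¬ lin i j c ∣ p := by
  rintro ⟨q, rfl⟩
  simp [h0] at hp

theorem mem_integralPolys_of_lin_mul {i j : Fin 2} (hij : i ≠ j) {c : ℂ} (hc : c ∈ Rring)
    {q : MvPolynomial (Fin 2) ℂ} (h : lin i j c * q ∈ integralPolys) : q ∈ integralPolys := by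
  classical
  rw [mem_integralPolys] at h ⊢
  suffices H : ∀ n, ∀ d : Fin 2 →₀ ℕ, d j = n → q.coeff d ∈ Rring from fun d => H _ d rfl
  intro n
  induction n with
  | zero =>
    intro d hd
    have h1 := h (d + Finsupp.single i 1)
    rw [lin, add_mul, coeff_add, mul_comm (X i), coeff_mul_X, mul_assoc, coeff_C_mul,
      coeff_X_mul', if_neg (by simp [hd, hij])] at h1
    simpa using h1
  | succ n ih =>
    intro d hd
    have h1 := h (d + Finsupp.single i 1)
    rw [lin, add_mul, coeff_add, mul_comm (X i), coeff_mul_X, mul_assoc, coeff_C_mul,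
      coeff_X_mul', if_pos (by simp [hd])] at h1
    have h2 := ih (d + Finsupp.single i 1 - Finsupp.single j 1) (by simp [hd, hij])
    simpa using sub_mem h1 (mul_mem hc h2)

/-! ### The generators of `G₁₂` -/

/-- The primitive eighth root of unity `e^{-iπ/4}`. -/
noncomputable def η : ℂ := (Real.sqrt 2 : ℂ)⁻¹ * (1 - I)

theorem η_sq : η ^ 2 = -I := by
  rw [η]
  linear_combination (1 - I) ^ 2 * inv_sqrt_two_sq + (1 / 2) * I_sq

theorem η_ne_zero : η ≠ 0 := by
  intro h
  have := η_sq
  rw [h] at this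
  simp at this

theorem orderOf_η : orderOf η = 8 := by
  have h4 : η ^ 4 = -1 := by linear_combination (η ^ 2 - I) * η_sq + I_sq
  refine orderOf_eq_prime_pow (p := 2) (n := 2) ?_ ?_
  · norm_num [h4]
  · norm_num
    linear_combination (η ^ 4 - 1) * h4

theorem Umat_inv : Umat⁻¹ = (Real.sqrt 2 : ℂ)⁻¹ • !![1 + I, -(1 + I); 1 - I, 1 + I] := by
  refine Matrix.inv_eq_right_inv ?_
  have h := inv_sqrt_two_sq
  ext a b
  fin_cases a <;> fin_cases b <;> simp [Umat, Matrix.mul_apply, Fin.sum_univ_two]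
  · linear_combination 2 * h
  · ring
  · linear_combination h * (I + I ^ 2 + 1 - I) + (1 / 2) * I_sq
  · linear_combination h * (-I - I ^ 2 + 1 + I) - (1 / 2) * I_sq

/-- The matrix `U S U⁻¹`. -/
noncomputable def Amat : Matrix (Fin 2) (Fin 2) ℂ := !![η, η * (I - 1); η, -η]

/-- The matrix `U T U⁻¹`. -/
noncomputable def Bmat : Matrix (Fin 2) (Fin 2) ℂ := !![0, 1; -1, 1]

theorem Umat_mul_Smat_mul_inv : Umat * Smat * Umat⁻¹ = Amat := by
  rw [Umat_inv]
  have h := inv_sqrt_two_sq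
  ext a b
  fin_cases a <;> fin_cases b <;>
    simp [Umat, Smat, Amat, η, Matrix.mul_apply, Fin.sum_univ_two] <;>
    generalize ((Real.sqrt 2 : ℂ))⁻¹ = s at * <;> grind [I_sq]

theorem Umat_mul_Tmat_mul_inv : Umat * Tmat * Umat⁻¹ = Bmat := by
  rw [Umat_inv]
  have h := inv_sqrt_two_sq
  have hε := ε_eq
  ext a b
  fin_cases a <;> fin_cases b <;>
    simp [Umat, Tmat, Bmat, hε, Matrix.mul_apply, Fin.sum_univ_two] <;>
    generalize ((Real.sqrt 2 : ℂ))⁻¹ = s at * <;> grind [I_sq]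

theorem Amat_det_ne_zero : Amat.det ≠ 0 := by
  have : Amat.det = -1 := by
    rw [Amat, Matrix.det_fin_two_of]
    linear_combination (-I) * η_sq + I_sq
  rw [this]
  norm_num

theorem Bmat_det_ne_zero : Bmat.det ≠ 0 := by
  simp [Bmat, Matrix.det_fin_two_of]

theorem actC_one : actC 1 = AlgHom.id ℂ _ := by
  refine MvPolynomial.algHom_ext fun i => ?_
  simp [actC, Matrix.one_apply]

theorem actC_mul (M N : Matrix (Fin 2) (Fin 2) ℂ) : actC (M * N) = (actC N).comp (actC M) := by
  refine MvPolynomial.algHom_ext fun i => ?_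
  simp [actC, Matrix.mul_apply, Fin.sum_univ_two, algebraMap_eq]
  ring

theorem eval_actC (M : Matrix (Fin 2) (Fin 2) ℂ) (v : Fin 2 → ℂ) (p : MvPolynomial (Fin 2) ℂ) :
    eval v (actC M p) = eval ![M 0 0 * v 0 + M 0 1 * v 1, M 1 0 * v 0 + M 1 1 * v 1] p := by
  have h : ((aeval v : MvPolynomial (Fin 2) ℂ →ₐ[ℂ] ℂ)).comp (actC M)
      = aeval ![M 0 0 * v 0 + M 0 1 * v 1, M 1 0 * v 0 + M 1 1 * v 1] := by
    refine MvPolynomial.algHom_ext fun i => ?_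
    fin_cases i <;> simp [actC, Fin.sum_univ_two]
  exact DFunLike.congr_fun h p

theorem mem_invariantRingC_G12 {p : MvPolynomial (Fin 2) ℂ} :
    p ∈ invariantRingC Rring G12 ↔ p ∈ integralPolys ∧ actC Amat p = p ∧ actC Bmat p = p := by
  rw [invariantRingC, Algebra.mem_inf, Subalgebra.mem_restrictScalars]
  simp only [Algebra.mem_iInf, AlgHom.mem_equalizer, AlgHom.id_apply]
  refine and_congr Iff.rfl ⟨fun h => ⟨?_, ?_⟩, fun ⟨hA, hB⟩ g hg => ?_⟩
  · refine h (Matrix.GeneralLinearGroup.mkOfDetNeZero Amat Amat_det_ne_zero)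
      (Subgroup.subset_closure (Or.inl ?_))
    exact Umat_mul_Smat_mul_inv.symm
  · refine h (Matrix.GeneralLinearGroup.mkOfDetNeZero Bmat Bmat_det_ne_zero)
      (Subgroup.subset_closure (Or.inr ?_))
    exact Umat_mul_Tmat_mul_inv.symm
  · induction hg using Subgroup.closure_induction with
    | mem g hg =>
      rcases hg with hg | hg
      · rw [hg, Umat_mul_Smat_mul_inv, hA]
      · rw [hg, Umat_mul_Tmat_mul_inv, hB]
    | one => rw [Units.val_one, actC_one, AlgHom.id_apply]
    | mul a b _ _ ha hb => rw [Units.val_mul, actC_mul, AlgHom.comp_apply, ha, hb]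
    | inv a _ ha =>
      conv_lhs => rw [← ha, ← AlgHom.comp_apply, ← actC_mul, ← Units.val_mul, mul_inv_cancel,
        Units.val_one, actC_one, AlgHom.id_apply]

/-! ### The invariants `f` and `g` -/

theorem eval_fpoly (v : Fin 2 → ℂ) : eval v fpoly =
    (I + 1) * v 0^5 * v 1 - 5 * v 0^4 * v 1^2 + (5*(1 - I)) * v 0^3 * v 1^3
    + (5*I) * v 0^2 * v 1^4 - (I + 1) * v 0 * v 1^5 := by
  simp [fpoly, xv, yv]

theorem eval_gpoly (v : Fin 2 → ℂ) : eval v gpoly =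
    v 0^8 + (4*(I - 1)) * v 0^7 * v 1 - (14*I) * v 0^6 * v 1^2 + (14*(I + 1)) * v 0^5 * v 1^3
    - 21 * v 0^4 * v 1^4 + (14*(1 - I)) * v 0^3 * v 1^5 + (14*I) * v 0^2 * v 1^6
    - (4*(I + 1)) * v 0 * v 1^7 + v 1^8 := by
  simp [gpoly, xv, yv]

theorem fpoly_eq_prod : fpoly = C I * lin 1 0 0 * lin 1 0 (-1) * lin 0 1 0 * lin 0 1 (I - 1) *
    lin 1 0 (-(1 + I)) * lin 1 0 (-I) := by
  refine MvPolynomial.funext fun v => ?_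
  rw [eval_fpoly]
  simp only [lin, map_mul, map_add, eval_C, eval_X]
  generalize v 0 = a
  generalize v 1 = b
  grind [I_sq]

theorem actC_Amat_fpoly : actC Amat fpoly = fpoly := by
  refine MvPolynomial.funext fun v => ?_
  rw [eval_actC, eval_fpoly, eval_fpoly]
  simp [Amat]
  generalize v 0 = a
  generalize v 1 = b
  have := η_sq
  grind [I_sq]

theorem actC_Bmat_fpoly : actC Bmat fpoly = fpoly := by
  refine MvPolynomial.funext fun v => ?_
  rw [eval_actC, eval_fpoly, eval_fpoly]
  simp [Bmat]
  generalize v 0 = a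
  generalize v 1 = b
  grind [I_sq]

theorem actC_Amat_gpoly : actC Amat gpoly = gpoly := by
  refine MvPolynomial.funext fun v => ?_
  rw [eval_actC, eval_gpoly, eval_gpoly]
  simp [Amat]
  generalize v 0 = a
  generalize v 1 = b
  have := η_sq
  grind [I_sq]

theorem actC_Bmat_gpoly : actC Bmat gpoly = gpoly := by
  refine MvPolynomial.funext fun v => ?_
  rw [eval_actC, eval_gpoly, eval_gpoly]
  simp [Bmat]
  generalize v 0 = a
  generalize v 1 = b
  grind [I_sq]

theorem fpoly_mem_integralPolys : fpoly ∈ integralPolys := by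
  have hI := C_mem_integralPolys I_mem_Rring
  have hx := X_mem_integralPolys 0
  have hy := X_mem_integralPolys 1
  have hn := fun n : ℕ => natCast_mem integralPolys n
  have h5 : (5 : MvPolynomial (Fin 2) ℂ) ∈ integralPolys := by exact_mod_cast hn 5
  simp only [fpoly, xv, yv, C_mul, C_add, C_sub, C_1, map_ofNat]
  have h1 := one_mem integralPolys
  repeat' first
    | assumption
    | apply add_mem
    | apply sub_mem
    | apply mul_mem

theorem gpoly_mem_integralPolys : gpoly ∈ integralPolys := by
  have hI := C_mem_integralPolys I_mem_Rring
  have hx := X_mem_integralPolys 0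
  have hy := X_mem_integralPolys 1
  have hn := fun n : ℕ => natCast_mem integralPolys n
  have h4 : (4 : MvPolynomial (Fin 2) ℂ) ∈ integralPolys := by exact_mod_cast hn 4
  have h14 : (14 : MvPolynomial (Fin 2) ℂ) ∈ integralPolys := by exact_mod_cast hn 14
  have h21 : (21 : MvPolynomial (Fin 2) ℂ) ∈ integralPolys := by exact_mod_cast hn 21
  simp only [gpoly, xv, yv, C_mul, C_add, C_sub, C_1, map_ofNat]
  have h1 := one_mem integralPolys
  repeat' first
    | assumption
    | apply add_mem
    | apply sub_mem
    | apply mul_mem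

theorem fpoly_mem_invariantRingC : fpoly ∈ invariantRingC Rring G12 :=
  mem_invariantRingC_G12.2 ⟨fpoly_mem_integralPolys, actC_Amat_fpoly, actC_Bmat_fpoly⟩

theorem gpoly_mem_invariantRingC : gpoly ∈ invariantRingC Rring G12 :=
  mem_invariantRingC_G12.2 ⟨gpoly_mem_integralPolys, actC_Amat_gpoly, actC_Bmat_gpoly⟩

theorem fpoly_ne_zero : fpoly ≠ 0 := by
  rw [fpoly_eq_prod]
  simp [lin_ne_zero]

theorem totalDegree_fpoly_pos : 0 < fpoly.totalDegree := by
  rw [Nat.pos_iff_ne_zero]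
  intro h
  rw [totalDegree_eq_zero_iff_eq_C] at h
  have h1 := congrArg (eval ![1, 0]) h
  rw [eval_C, eval_fpoly] at h1
  rw [← show (0 : ℂ) = fpoly.coeff 0 by simpa using h1, C_0] at h
  exact fpoly_ne_zero h

theorem totalDegree_gpoly_le : gpoly.totalDegree ≤ 8 := by
  have hd : gpoly.IsHomogeneous 8 := by
    have hx := fun n => (isHomogeneous_X ℂ (0 : Fin 2)).pow n
    have hy := fun n => (isHomogeneous_X ℂ (1 : Fin 2)).pow n
    have hC := fun c : ℂ => isHomogeneous_C (Fin 2) c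
    have h21 := isHomogeneous_C (Fin 2) (21 : ℂ)
    simp only [one_mul, map_ofNat] at hx hy h21
    have hx1 := isHomogeneous_X ℂ (0 : Fin 2)
    have hy1 := isHomogeneous_X ℂ (1 : Fin 2)
    unfold gpoly xv yv
    exact ((((((((hx 8).add (((hC _).mul (hx 7)).mul hy1)).sub
      (((hC _).mul (hx 6)).mul (hy 2))).add (((hC _).mul (hx 5)).mul (hy 3))).sub
      ((h21.mul (hx 4)).mul (hy 4))).add (((hC _).mul (hx 3)).mul (hy 5))).add
      (((hC _).mul (hx 2)).mul (hy 6))).sub (((hC _).mul hx1).mul (hy 7))).add (hy 8)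
  exact hd.totalDegree_le

/-! ### Restriction to the line `y = 0` -/

/-- Restriction of a polynomial to the line `y = 0`. -/
noncomputable def restrictLine : MvPolynomial (Fin 2) ℂ →ₐ[ℂ] Polynomial ℂ :=
  aeval ![Polynomial.X, 0]

theorem restrictLine_fpoly : restrictLine fpoly = 0 := by
  simp [restrictLine, fpoly, xv, yv]

theorem restrictLine_gpoly : restrictLine gpoly = Polynomial.X ^ 8 := by
  simp [restrictLine, gpoly, xv, yv]

theorem coeff_restrictLine (p : MvPolynomial (Fin 2) ℂ) (n : ℕ) :
    (restrictLine p).coeff n = p.coeff (Finsupp.single 0 n) := by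
  classical
  induction p using MvPolynomial.induction_on' with
  | monomial u a =>
    rw [restrictLine, aeval_monomial, Finsupp.prod_fintype _ _ (fun _ => pow_zero _),
      Fin.prod_univ_two, coeff_monomial, Polynomial.algebraMap_eq, Polynomial.coeff_C_mul]
    by_cases h1 : u 1 = 0
    · have hu : u = Finsupp.single 0 n ↔ n = u 0 := by
        rw [Finsupp.ext_iff]
        simp [Fin.forall_fin_two, h1, eq_comm]
      simp [h1, hu, Polynomial.coeff_X_pow]
    · have hu : u ≠ Finsupp.single 0 n := by
        rintro rfl
        simp at h1
      simp [h1, hu]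
  | add p q hp hq => rw [map_add, Polynomial.coeff_add, coeff_add, hp, hq]

theorem restrictLine_C (c : ℂ) : restrictLine (C c) = Polynomial.C c :=
  restrictLine.commutes c

theorem lin_one_zero_dvd {p : MvPolynomial (Fin 2) ℂ} (h : restrictLine p = 0) :
    lin 1 0 0 ∣ p := by
  have h1 : ((Polynomial.aeval (X 0 : MvPolynomial (Fin 2) ℂ)).comp restrictLine)
      = aeval (Function.update X 1 (-(C 0 * X 0))) := by
    refine MvPolynomial.algHom_ext fun i => ?_
    fin_cases i <;> simp [restrictLine]
  rw [lin_dvd_iff (by decide), ← h1, AlgHom.comp_apply, h, map_zero]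

theorem restrictLine_comp_C_η_mul_X {p : MvPolynomial (Fin 2) ℂ} (hA : actC Amat p = p)
    (hB : actC Bmat p = p) :
    (restrictLine p).comp (Polynomial.C η * Polynomial.X) = restrictLine p := by
  have h : (Polynomial.aeval (Polynomial.C η * Polynomial.X)).comp restrictLine
      = restrictLine.comp ((actC Amat).comp (actC Bmat)) := by
    refine MvPolynomial.algHom_ext fun i => ?_
    fin_cases i <;> simp [restrictLine, actC, Amat, Bmat, Fin.sum_univ_two]
  have h1 := DFunLike.congr_fun h p
  simp only [AlgHom.comp_apply, hA, hB] at h1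
  exact h1

theorem coeff_restrictLine_eq_zero {p : MvPolynomial (Fin 2) ℂ} (hA : actC Amat p = p)
    (hB : actC Bmat p = p) {n : ℕ} (hn : ¬ 8 ∣ n) : (restrictLine p).coeff n = 0 := by
  have h := congrArg (fun q => Polynomial.coeff q n) (restrictLine_comp_C_η_mul_X hA hB)
  simp only [Polynomial.comp_C_mul_X_coeff] at h
  by_contra h0
  refine hn ?_
  rw [← orderOf_η, orderOf_dvd_iff_pow_eq_one]
  exact mul_left_cancel₀ h0 (by rw [h, mul_one])

/-! ### Divisibility of invariants by `f` -/

theorem lin_dvd_of_actC {M : Matrix (Fin 2) (Fin 2) ℂ} {p l l' : MvPolynomial (Fin 2) ℂ} (c : ℂ)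
    (hM : actC M p = p) (hl : actC M l = C c * l') (h : l ∣ p) : l' ∣ p := by
  have := map_dvd (actC M) h
  rw [hM, hl] at this
  exact (dvd_mul_left _ _).trans this

theorem dvd_mul_lin {i j : Fin 2} (hij : i ≠ j) {c : ℂ} {m p : MvPolynomial (Fin 2) ℂ}
    (v : Fin 2 → ℂ) (h0 : eval v (lin i j c) = 0) (hm : eval v m ≠ 0)
    (h1 : m ∣ p) (h2 : lin i j c ∣ p) : m * lin i j c ∣ p := by
  obtain ⟨q, rfl⟩ := h1
  exact mul_dvd_mul_left m
    (((prime_lin hij c).dvd_or_dvd h2).resolve_left (not_lin_dvd_of_eval v h0 hm))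

theorem fpoly_dvd {p : MvPolynomial (Fin 2) ℂ} (hA : actC Amat p = p) (hB : actC Bmat p = p)
    (h : restrictLine p = 0) : fpoly ∣ p := by
  have h1 : lin 1 0 0 ∣ p := lin_one_zero_dvd h
  have h2 : lin 1 0 (-1) ∣ p := by
    refine lin_dvd_of_actC (-η) hA ?_ h1
    simp [actC, lin, Amat, Fin.sum_univ_two]
    ring
  have h3 : lin 0 1 0 ∣ p := by
    refine lin_dvd_of_actC (-1) hB ?_ h2
    simp [actC, lin, Bmat, Fin.sum_univ_two]
  have h4 : lin 0 1 (I - 1) ∣ p := by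
    refine lin_dvd_of_actC η hA ?_ h3
    simp [actC, lin, Amat, Fin.sum_univ_two]
    ring
  have hI : (C I * C I : MvPolynomial (Fin 2) ℂ) = -1 := by
    rw [← C_mul, I_mul_I, C_neg, C_1]
  have h5 : lin 1 0 (-(1 + I)) ∣ p := by
    refine lin_dvd_of_actC I hB ?_ h4
    simp [actC, lin, Bmat, Fin.sum_univ_two, algebraMap_eq]
    linear_combination X 0 * hI
  have h6 : lin 1 0 (-I) ∣ p := by
    refine lin_dvd_of_actC (-I) hB ?_ h5
    simp [actC, lin, Bmat, Fin.sum_univ_two, algebraMap_eq]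
    linear_combination (-X 0) * hI
  rw [fpoly_eq_prod]
  have hu : C I * lin 1 0 0 ∣ p := by
    obtain ⟨q, rfl⟩ := h1
    exact ⟨-(C I * q), by linear_combination (lin 1 0 0 * q) * hI⟩
  refine dvd_mul_lin (by decide) ![1, I] ?_ ?_ (dvd_mul_lin (by decide) ![1, 1 + I] ?_ ?_
    (dvd_mul_lin (by decide) ![1 - I, 1] ?_ ?_ (dvd_mul_lin (by decide) ![0, 1] ?_ ?_
    (dvd_mul_lin (by decide) ![1, 1] ?_ ?_ hu h2) h3) h4) h5) h6 <;>
  simp [lin, Complex.ext_iff]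

theorem mem_integralPolys_of_fpoly_mul {q : MvPolynomial (Fin 2) ℂ}
    (h : fpoly * q ∈ integralPolys) : q ∈ integralPolys := by
  have hI := I_mem_Rring
  have h1 := one_mem Rring
  have h' : lin 1 0 0 * (lin 1 0 (-1) * (lin 0 1 0 * (lin 0 1 (I - 1) *
      (lin 1 0 (-(1 + I)) * (lin 1 0 (-I) * q))))) ∈ integralPolys := by
    have h2 := mul_mem (C_mem_integralPolys (neg_mem hI)) h
    have hI2 : (C I * C I : MvPolynomial (Fin 2) ℂ) = -1 := by
      rw [← C_mul, I_mul_I, C_neg, C_1]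
    convert h2 using 1
    rw [fpoly_eq_prod, C_neg]
    linear_combination (lin 1 0 0 * (lin 1 0 (-1) * (lin 0 1 0 * (lin 0 1 (I - 1) *
      (lin 1 0 (-(1 + I)) * (lin 1 0 (-I) * q)))))) * hI2
  exact mem_integralPolys_of_lin_mul (by decide) (neg_mem hI)
    (mem_integralPolys_of_lin_mul (by decide) (neg_mem (add_mem h1 hI))
    (mem_integralPolys_of_lin_mul (by decide) (sub_mem hI h1)
    (mem_integralPolys_of_lin_mul (by decide) (zero_mem _)
    (mem_integralPolys_of_lin_mul (by decide) (neg_mem h1)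
    (mem_integralPolys_of_lin_mul (by decide) (zero_mem _) h')))))

/-! ### The invariant ring -/

theorem mem_invariantRingC_of_fpoly_mul {q : MvPolynomial (Fin 2) ℂ}
    (h : fpoly * q ∈ invariantRingC Rring G12) : q ∈ invariantRingC Rring G12 := by
  rw [mem_invariantRingC_G12] at h ⊢
  obtain ⟨h1, h2, h3⟩ := h
  rw [map_mul, actC_Amat_fpoly] at h2
  rw [map_mul, actC_Bmat_fpoly] at h3
  exact ⟨mem_integralPolys_of_fpoly_mul h1, mul_left_cancel₀ fpoly_ne_zero h2,
    mul_left_cancel₀ fpoly_ne_zero h3⟩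

theorem exists_adjoin_gpoly {p : MvPolynomial (Fin 2) ℂ} (hp : p ∈ invariantRingC Rring G12) :
    ∃ r ∈ Algebra.adjoin ↥Rring {gpoly}, restrictLine r = restrictLine p ∧
      r.totalDegree ≤ p.totalDegree := by
  obtain ⟨hL, hA, hB⟩ := mem_invariantRingC_G12.1 hp
  rw [mem_integralPolys] at hL
  refine ⟨∑ j ∈ Finset.range (p.totalDegree / 8 + 1),
    C (p.coeff (Finsupp.single 0 (8 * j))) * gpoly ^ j, ?_, ?_, ?_⟩
  · have hg : gpoly ∈ Algebra.adjoin ↥Rring {gpoly} := Algebra.subset_adjoin rfl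
    have hC : ∀ d, C (p.coeff d) ∈ Algebra.adjoin ↥Rring {gpoly} := fun d =>
      Subalgebra.algebraMap_mem _ (⟨_, hL d⟩ : ↥Rring)
    exact Subalgebra.sum_mem _ fun j _ => Subalgebra.mul_mem _ (hC _) (Subalgebra.pow_mem _ hg j)
  · ext n
    simp only [map_sum, map_mul, map_pow, restrictLine_gpoly, restrictLine_C, ← pow_mul, Polynomial.finsetSum_coeff,
      Polynomial.coeff_C_mul_X_pow]
    by_cases hn : 8 ∣ n
    · obtain ⟨k, rfl⟩ := hn
      by_cases hk : k < p.totalDegree / 8 + 1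
      · rw [Finset.sum_eq_single k]
        · simp [coeff_restrictLine]
        · intro b _ hb
          rw [if_neg (by omega)]
        · simp [hk]
      · rw [coeff_restrictLine, coeff_eq_zero_of_totalDegree_lt, Finset.sum_eq_zero]
        · intro b hb
          rw [Finset.mem_range] at hb
          rw [if_neg (by omega)]
        · rw [← Finsupp.degree_apply, Finsupp.degree_single]
          omega
    · rw [coeff_restrictLine_eq_zero hA hB hn]
      refine Finset.sum_eq_zero fun j _ => if_neg ?_
      rintro rfl
      exact hn (dvd_mul_right _ _)
  · refine totalDegree_finsetSum_le fun j hj => ?_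
    rw [Finset.mem_range] at hj
    have h1 := totalDegree_mul (C (p.coeff (Finsupp.single 0 (8 * j)))) (gpoly ^ j)
    have h2 := totalDegree_pow gpoly j
    have h3 := Nat.mul_le_mul_left j totalDegree_gpoly_le
    rw [totalDegree_C] at h1
    omega

theorem adjoin_gpoly_le : Algebra.adjoin ↥Rring {gpoly} ≤ invariantRingC Rring G12 :=
  Algebra.adjoin_le (Set.singleton_subset_iff.2 gpoly_mem_invariantRingC)

theorem invariantRingC_le_adjoin :
    invariantRingC Rring G12 ≤ Algebra.adjoin ↥Rring {fpoly, gpoly} := by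
  intro p
  induction hn : p.totalDegree using Nat.strong_induction_on generalizing p with
  | _ n ih =>
    intro hp
    subst hn
    obtain ⟨r, hr, hrp, hdeg⟩ := exists_adjoin_gpoly hp
    have hpr := sub_mem hp (adjoin_gpoly_le hr)
    have hr' : r ∈ Algebra.adjoin ↥Rring {fpoly, gpoly} := Algebra.adjoin_mono (by simp) hr
    obtain ⟨-, hA, hB⟩ := mem_invariantRingC_G12.1 hpr
    obtain ⟨q, hq⟩ := fpoly_dvd hA hB (by rw [map_sub, hrp, sub_self])
    have hq_inv : q ∈ invariantRingC Rring G12 := mem_invariantRingC_of_fpoly_mul (hq ▸ hpr)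
    rw [← sub_add_cancel p r, hq]
    refine add_mem (mul_mem (Algebra.subset_adjoin (by simp)) ?_) hr'
    by_cases hq0 : q = 0
    · rw [hq0]
      exact zero_mem _
    refine ih _ ?_ rfl hq_inv
    have h1 := totalDegree_sub p r
    rw [hq, totalDegree_mul_of_isDomain fpoly_ne_zero hq0, max_eq_left hdeg] at h1
    have h2 := totalDegree_fpoly_pos
    omega

theorem algebraicIndependent_fpoly_gpoly : AlgebraicIndependent ↥Rring ![fpoly, gpoly] := by
  refine AlgebraicIndependent.restrictScalars (K := ℂ) Subtype.val_injective ?_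
  rw [algebraicIndependent_iff]
  intro p
  induction hn : p.totalDegree using Nat.strong_induction_on generalizing p with
  | _ n ih =>
    intro hp
    subst hn
    have h1 : (Polynomial.expand ℂ 8).comp (aeval ![0, Polynomial.X])
        = restrictLine.comp (aeval ![fpoly, gpoly]) := by
      refine MvPolynomial.algHom_ext fun i => ?_
      fin_cases i <;> simp [restrictLine_fpoly, restrictLine_gpoly]
    have h2 := DFunLike.congr_fun h1 p
    rw [AlgHom.comp_apply, AlgHom.comp_apply, hp, map_zero, Polynomial.expand_eq_zero (by decide)]
      at h2
    have h3 : (Polynomial.aeval (R := ℂ) (X 1 : MvPolynomial (Fin 2) ℂ)).comp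
        (aeval ![0, (Polynomial.X : Polynomial ℂ)]) = aeval (Function.update X 0 (-(C 0 * X 1))) := by
      refine MvPolynomial.algHom_ext fun i => ?_
      fin_cases i <;> simp
    have h4 : lin 0 1 0 ∣ p := by
      rw [lin_dvd_iff (by decide), ← h3, AlgHom.comp_apply, h2, map_zero]
    have hlin : lin 0 1 0 = (X 0 : MvPolynomial (Fin 2) ℂ) := by simp [lin]
    obtain ⟨q, rfl⟩ := h4
    rw [hlin] at hp ih ⊢
    by_cases hq0 : q = 0
    · rw [hq0, mul_zero]
    rw [map_mul, aeval_X] at hp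
    rw [ih q.totalDegree ?_ q rfl ((mul_eq_zero.1 hp).resolve_left fpoly_ne_zero), mul_zero]
    rw [totalDegree_mul_of_isDomain (X_ne_zero 0) hq0, totalDegree_X]
    omega

/-- the ring of invariants `R[x, y]^{G₁₂}` (with `R = ℤ[ε, ω]`) equals
`R[f, g]`, and `f`, `g` are algebraically independent; in particular it is a polynomial
ring over `R`. -/
theorem G12_invariants :
    invariantRingC Rring G12 = Algebra.adjoin ↥Rring {fpoly, gpoly} ∧
    AlgebraicIndependent ↥Rring ![fpoly, gpoly] ∧
    ∃ k : ℕ, Nonempty (↥(invariantRingC Rring G12) ≃ₐ[↥Rring] MvPolynomial (Fin k) ↥Rring) := by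
  have h : invariantRingC Rring G12 = Algebra.adjoin ↥Rring {fpoly, gpoly} := by
    refine le_antisymm invariantRingC_le_adjoin (Algebra.adjoin_le ?_)
    rintro _ (rfl | rfl)
    exacts [fpoly_mem_invariantRingC, gpoly_mem_invariantRingC]
  have hr : Set.range ![fpoly, gpoly] = {fpoly, gpoly} := by simp [Set.pair_comm]
  refine ⟨h, algebraicIndependent_fpoly_gpoly, 2, ⟨?_⟩⟩
  rw [h, ← hr]
  exact algebraicIndependent_fpoly_gpoly.aevalEquiv.symm
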